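/- Let C₄ be the 4-corner Cantor set. There exists a universal constant c > 0 such that for every ε ∈ (0, 1/2) there exists a Lipschitz graph Γ ⊆ ℝ² satisfying dim(C₄ ∩ Γ) ≥ 1 − ε and Lip(Γ) ≤ c·2^{1/ε}. -/

import Mathlib

open Set MeasureTheory Metric Real
open scoped ENNReal NNReal

noncomputable section

/-- The plane `ℝ²` with the Euclidean metric. -/
abbrev E2 : Type := EuclideanSpace ℝ (Fin 2)

/-- The point `(x, y) ∈ ℝ²`. -/
def pt (x y : ℝ) : E2 := (WithLp.equiv 2 (Fin 2 → ℝ)).symm ![x, y]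

/-- The translations of the four maps `f_j(x) = x/4 + z_j` of the 4-corner Cantor IFS. -/
def cantorZ : Fin 4 → E2 := ![pt 0 0, pt 0 (3 / 4), pt (3 / 4) 0, pt (3 / 4) (3 / 4)]

/-- `Γ ⊆ ℝ²` is a Lipschitz graph with Lipschitz constant at most `L`: it is the image under
a rotation (linear isometry) of the graph of an `L`-Lipschitz function `g` over an interval. -/
def IsLipGraph (Γ : Set E2) (L : ℝ) : Prop :=
  ∃ (I : Set ℝ) (g : ℝ → ℝ) (R : E2 ≃ₗᵢ[ℝ] E2),
    I.OrdConnected ∧ LipschitzOnWith (Real.toNNReal L) g I ∧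
    Γ = R '' ((fun x => pt x (g x)) '' I)

/-- Every symbolic sequence over the maps `x ↦ q • x + z b` preserving a compact set `K`
is the address of a point of `K`. -/
lemma exists_coding {E ι : Type*} [NormedAddCommGroup E] [NormedSpace ℝ E] [CompleteSpace E]
    [Finite ι] {K : Set E} (hK : IsCompact K) (hne : K.Nonempty) {q : ℝ} (hq0 : 0 ≤ q)
    (hq1 : q < 1) (z : ι → E) (hz : ∀ b, ∀ x ∈ K, q • x + z b ∈ K) :
    ∃ P : (ℕ → ι) → E, (∀ σ, P σ ∈ K) ∧
      ∀ σ, P σ = q • P (fun i => σ (i + 1)) + z (σ 0) := by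
  obtain ⟨B, hB⟩ := (Set.finite_range fun b => ‖z b‖).bddAbove
  have hzB : ∀ b, ‖z b‖ ≤ B := fun b => hB ⟨b, rfl⟩
  have hsum : ∀ σ : ℕ → ι, Summable fun i => q ^ i • z (σ i) := fun σ => by
    refine Summable.of_norm_bounded
      ((summable_geometric_of_lt_one hq0 hq1).mul_right B) fun i => ?_
    rw [norm_smul, norm_pow, Real.norm_of_nonneg hq0]
    exact mul_le_mul_of_nonneg_left (hzB _) (by positivity)
  refine ⟨fun σ => ∑' i, q ^ i • z (σ i), fun σ => ?_, fun σ => ?_⟩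
  · have hmem : ∀ n : ℕ, ∀ x ∈ K, ∑ i ∈ Finset.range n, q ^ i • z (σ i) + q ^ n • x ∈ K := by
      intro n
      induction n with
      | zero => intro x hx; simpa using hx
      | succ n ih =>
        intro x hx
        convert! ih _ (hz (σ n) x hx) using 1
        rw [Finset.sum_range_succ, smul_add, smul_smul, pow_succ]
        abel
    obtain ⟨x, hx⟩ := hne
    have hlim := (hsum σ).hasSum.tendsto_sum_nat.add
      ((tendsto_pow_atTop_nhds_zero_of_lt_one hq0 hq1).smul_const x)
    rw [zero_smul, add_zero] at hlim
    exact hK.isClosed.mem_of_tendsto hlim (Filter.Eventually.of_forall fun n => hmem n x hx)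
  · dsimp only
    rw [(hsum σ).tsum_eq_zero_add, ← tsum_const_smul'' q, add_comm]
    simp [pow_succ', smul_smul]

/-- The linear functional `(x, y) ↦ 2x + y`, which maps the 4-corner Cantor set onto `[0, 3]`. -/
def slant (v : E2) : ℝ := 2 * v 0 + v 1

lemma slant_smul_add (q : ℝ) (x z : E2) : slant (q • x + z) = q * slant x + slant z := by
  simp [slant]; ring

lemma slant_cantorZ (j : Fin 4) : slant (cantorZ j) = 3 / 4 * (j : ℕ) := by
  fin_cases j <;> norm_num [slant, cantorZ, pt]

lemma continuous_slant : Continuous slant := by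
  unfold slant; fun_prop

/-- The reflection whose first coordinate is the normalisation of `slant`. -/
def reflection : E2 ≃ₗᵢ[ℝ] E2 where
  toFun v := pt ((2 * v 0 + v 1) / √5) ((v 0 - 2 * v 1) / √5)
  invFun v := pt ((2 * v 0 + v 1) / √5) ((v 0 - 2 * v 1) / √5)
  map_add' v w := by
    ext i; fin_cases i <;> simp [pt] <;> ring
  map_smul' q v := by
    ext i; fin_cases i <;> simp [pt] <;> ring
  left_inv v := by
    have h : √5 ^ 2 = 5 := Real.sq_sqrt (by norm_num)
    ext i; fin_cases i <;> simp [pt] <;> field_simp <;> rw [h] <;> ring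
  right_inv v := by
    have h : √5 ^ 2 = 5 := Real.sq_sqrt (by norm_num)
    ext i; fin_cases i <;> simp [pt] <;> field_simp <;> rw [h] <;> ring
  norm_map' v := by
    have h : √5 ^ 2 = 5 := Real.sq_sqrt (by norm_num)
    simp only [EuclideanSpace.norm_eq, Fin.sum_univ_two, Real.norm_eq_abs, sq_abs]
    congr 1
    simp [pt, div_pow, h]
    ring

lemma reflection_apply_zero (v : E2) : reflection v 0 = slant v / √5 := by
  simp [reflection, slant, pt]

lemma reflection_reflection (v : E2) : reflection (reflection v) = v :=
  reflection.left_inv v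

lemma abs_sub_apply_le_dist (v w : E2) (i : Fin 2) : |v i - w i| ≤ dist v w := by
  rw [dist_eq_norm, ← Real.norm_eq_abs]
  exact PiLp.norm_apply_le (v - w) i

lemma abs_slant_sub_le (v w : E2) : |slant v - slant w| ≤ √5 * dist v w := by
  have h := abs_sub_apply_le_dist (reflection v) (reflection w) 0
  rwa [reflection.dist_map, reflection_apply_zero, reflection_apply_zero, ← sub_div, abs_div,
    abs_of_nonneg (Real.sqrt_nonneg 5), div_le_iff₀' (by positivity)] at h

/-- A family of points whose slants determine it in a Lipschitz way lies on a Lipschitz graph. -/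
lemma exists_isLipGraph {ι : Type*} (P : ι → E2) {L : ℝ}
    (h : ∀ σ τ, dist (P σ) (P τ) ≤ L * |slant (P σ) / √5 - slant (P τ) / √5|) :
    ∃ Γ, IsLipGraph Γ L ∧ range P ⊆ Γ := by
  have hfac : ∀ σ τ, slant (P σ) / √5 = slant (P τ) / √5 → P σ = P τ := fun σ τ hst => by
    have := h σ τ
    rw [hst, sub_self, abs_zero, mul_zero] at this
    exact dist_le_zero.1 this
  let g₀ : ℝ → ℝ := Function.extend (fun σ => slant (P σ) / √5) (fun σ => reflection (P σ) 1) 0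
  have hg₀ : ∀ σ, g₀ (slant (P σ) / √5) = reflection (P σ) 1 := fun σ =>
    Function.FactorsThrough.extend_apply
      (f := fun σ => slant (P σ) / √5) (g := fun σ => reflection (P σ) 1)
      (fun σ τ hst => congrArg (fun v => reflection v 1) (hfac σ τ hst)) 0 σ
  have hlip : LipschitzOnWith L.toNNReal g₀ (range fun σ => slant (P σ) / √5) := by
    refine LipschitzOnWith.of_dist_le_mul ?_
    rintro _ ⟨σ, rfl⟩ _ ⟨τ, rfl⟩
    dsimp only
    rw [hg₀, hg₀, Real.dist_eq, Real.dist_eq]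
    refine (abs_sub_apply_le_dist _ _ _).trans ?_
    rw [reflection.dist_map]
    exact (h σ τ).trans (mul_le_mul_of_nonneg_right (Real.le_coe_toNNReal L) (abs_nonneg _))
  obtain ⟨g, hg, heq⟩ := hlip.extend_real
  refine ⟨_, ⟨univ, g, reflection, ordConnected_univ, hg.lipschitzOnWith, rfl⟩, ?_⟩
  rintro _ ⟨σ, rfl⟩
  refine ⟨reflection (P σ), ⟨slant (P σ) / √5, mem_univ _, ?_⟩, reflection_reflection _⟩
  dsimp only
  rw [← heq ⟨σ, rfl⟩, hg₀]
  ext i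
  fin_cases i <;> simp [pt, reflection_apply_zero]

/-- A Hölder-type lower bound for a symbolic coding bounds the dimension of its image below. -/
lemma le_dimH_range_coding {X : Type*} [MetricSpace X] {M : ℕ} (hM : 1 < M)
    {Q s : ℝ} (hQ : 1 < Q) (hs : 0 < s) (hMQ : (M : ℝ) = Q ^ s) (P : (ℕ → Fin M) → X)
    (hP : ∀ (k : ℕ) (σ τ : ℕ → Fin M), (∀ i < k, σ i = τ i) → σ k ≠ τ k →
      (Q ^ (k + 1))⁻¹ ≤ dist (P σ) (P τ)) :
    ENNReal.ofReal s ≤ dimH (range P) := by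
  classical
  have hQ0 : 0 < Q := by linarith
  have hfirst : ∀ σ τ : ℕ → Fin M, σ ≠ τ → ∃ k, (∀ i < k, σ i = τ i) ∧ σ k ≠ τ k := by
    intro σ τ hne
    have hex := Function.ne_iff.1 hne
    exact ⟨Nat.find hex, fun i hi => not_not.1 (Nat.find_min hex hi), Nat.find_spec hex⟩
  have hinj : Function.Injective P := fun σ τ heq => by
    by_contra hne
    obtain ⟨k, hk, hk'⟩ := hfirst σ τ hne
    have := hP k σ τ hk hk'
    rw [heq, dist_self] at this
    exact absurd this (not_le.2 (by positivity))
  let f : X → ℝ := Function.extend P Real.ofDigits 0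
  have hf : ∀ σ, f (P σ) = Real.ofDigits σ := fun σ => hinj.extend_apply _ _ σ
  have hholder : HolderOnWith M s.toNNReal f (range P) := by
    rintro _ ⟨σ, rfl⟩ _ ⟨τ, rfl⟩
    rcases eq_or_ne σ τ with rfl | hne
    · simp
    obtain ⟨k, hk, hk'⟩ := hfirst σ τ hne
    rw [hf, hf, edist_dist, edist_dist, Real.coe_toNNReal s hs.le,
      ENNReal.ofReal_rpow_of_nonneg dist_nonneg hs.le, ← ENNReal.ofReal_coe_nnreal,
      ← ENNReal.ofReal_mul (by positivity)]
    refine ENNReal.ofReal_le_ofReal ?_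
    rw [Real.dist_eq]
    calc |Real.ofDigits σ - Real.ofDigits τ| ≤ ((M : ℝ) ^ k)⁻¹ :=
          Real.abs_ofDigits_sub_ofDigits_le hk
      _ = M * ((Q ^ (k + 1))⁻¹) ^ s := by
          have hM0 : (M : ℝ) ≠ 0 := by positivity
          rw [Real.inv_rpow (by positivity), ← Real.rpow_natCast Q, ← Real.rpow_mul hQ0.le,
            mul_comm _ s, Real.rpow_mul hQ0.le, ← hMQ, Real.rpow_natCast, pow_succ]
          field_simp
      _ ≤ M * dist (P σ) (P τ) ^ s := by
          gcongr
          exact hP k σ τ hk hk'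
      _ = ((M : ℝ≥0) : ℝ) * dist (P σ) (P τ) ^ s := by simp
  have hs' : 0 < s.toNNReal := Real.toNNReal_pos.2 hs
  have hsub : Icc (0 : ℝ) 1 ⊆ f '' range P := fun y hy => by
    obtain ⟨σ, -, rfl⟩ := Real.ofDigits_SurjOn hM hy
    exact ⟨P σ, ⟨σ, rfl⟩, hf σ⟩
  have hdim : (1 : ℝ≥0∞) ≤ dimH (range P) / s.toNNReal := by
    refine le_trans ?_ ((dimH_mono hsub).trans (hholder.dimH_image_le hs'))
    rw [Real.dimH_of_nonempty_interior (by simp)]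
    simp
  rwa [ENNReal.le_div_iff_mul_le (by simp [hs]) (by simp), one_mul] at hdim

/-- Two points coded by maps `x ↦ x / Q + z b` of slants `6b/Q` are separated, after projection,
at the scale at which their addresses first differ. -/
lemma le_abs_slant_sub {M : ℕ} {Q : ℝ} (hQ : 0 < Q) (z : Fin M → E2)
    (hz : ∀ b, slant (z b) = 6 * (b : ℕ) / Q) (P : (ℕ → Fin M) → E2)
    (hP : ∀ σ, P σ = Q⁻¹ • P (fun i => σ (i + 1)) + z (σ 0))
    (h0 : ∀ σ, 0 ≤ slant (P σ)) (h3 : ∀ σ, slant (P σ) ≤ 3) (k : ℕ) :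
    ∀ σ τ : ℕ → Fin M, (∀ i < k, σ i = τ i) → σ k ≠ τ k →
      3 * (Q ^ (k + 1))⁻¹ ≤ |slant (P σ) - slant (P τ)| := by
  induction k with
  | zero =>
    intro σ τ _ hne
    rw [hP σ, hP τ, slant_smul_add, slant_smul_add, hz, hz]
    set x := slant (P fun i => σ (i + 1)) with hx
    set y := slant (P fun i => τ (i + 1)) with hy
    have hx0 : 0 ≤ x := h0 _
    have hx3 : x ≤ 3 := h3 _
    have hy0 : 0 ≤ y := h0 _
    have hy3 : y ≤ 3 := h3 _
    have heq : Q⁻¹ * x + 6 * ((σ 0 : ℕ) : ℝ) / Q - (Q⁻¹ * y + 6 * ((τ 0 : ℕ) : ℝ) / Q)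
        = Q⁻¹ * (6 * ((σ 0 : ℕ) - (τ 0 : ℕ)) + (x - y)) := by ring
    rw [heq, abs_mul, abs_of_pos (inv_pos.2 hQ), zero_add, pow_one, mul_comm]
    refine mul_le_mul_of_nonneg_left ?_ (by positivity)
    rcases lt_or_gt_of_ne (fun h => hne (Fin.ext h)) with h | h
    · have : ((σ 0 : ℕ) : ℝ) + 1 ≤ (τ 0 : ℕ) := by exact_mod_cast h
      exact le_abs.2 (Or.inr (by linarith))
    · have : ((τ 0 : ℕ) : ℝ) + 1 ≤ (σ 0 : ℕ) := by exact_mod_cast h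
      exact le_abs.2 (Or.inl (by linarith))
  | succ k ih =>
    intro σ τ heq hne
    have := ih (fun i => σ (i + 1)) (fun i => τ (i + 1))
      (fun i hi => heq (i + 1) (by omega)) hne
    rw [hP σ, hP τ, slant_smul_add, slant_smul_add, heq 0 (by omega), add_sub_add_right_eq_sub,
      ← mul_sub, abs_mul, abs_of_pos (inv_pos.2 hQ)]
    calc 3 * (Q ^ (k + 1 + 1))⁻¹ = Q⁻¹ * (3 * (Q ^ (k + 1))⁻¹) := by
          rw [pow_succ Q (k + 1), mul_inv]; ring
      _ ≤ _ := mul_le_mul_of_nonneg_left this (by positivity)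

/-- Points coded by maps of ratio `Q⁻¹` with a common initial segment of addresses are close. -/
lemma dist_coding_le {E ι : Type*} [NormedAddCommGroup E] [NormedSpace ℝ E] {Q D : ℝ}
    (hQ : 0 < Q) (z : ι → E) (P : (ℕ → ι) → E)
    (hP : ∀ σ, P σ = Q⁻¹ • P (fun i => σ (i + 1)) + z (σ 0))
    (hD : ∀ σ τ, dist (P σ) (P τ) ≤ D) (k : ℕ) :
    ∀ σ τ : ℕ → ι, (∀ i < k, σ i = τ i) → dist (P σ) (P τ) ≤ D * (Q ^ k)⁻¹ := by
  induction k with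
  | zero => intro σ τ _; simpa using hD σ τ
  | succ k ih =>
    intro σ τ heq
    have := ih (fun i => σ (i + 1)) (fun i => τ (i + 1)) fun i hi => heq (i + 1) (by omega)
    rw [hP σ, hP τ, heq 0 (by omega), dist_add_right, dist_smul₀, norm_inv,
      Real.norm_of_nonneg hQ.le]
    calc _ ≤ Q⁻¹ * (D * (Q ^ k)⁻¹) := mul_le_mul_of_nonneg_left this (by positivity)
      _ = _ := by rw [pow_succ, mul_inv]; ring

section Attractor

variable {C4 : Set E2}

lemma map_mem_attractor
    (hinv : C4 = ⋃ j : Fin 4, (fun x => (4 : ℝ)⁻¹ • x + cantorZ j) '' C4)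
    (j : Fin 4) {x : E2} (hx : x ∈ C4) : (4 : ℝ)⁻¹ • x + cantorZ j ∈ C4 := by
  rw [hinv]
  exact mem_iUnion.2 ⟨j, x, hx, rfl⟩

lemma exists_preimage_attractor
    (hinv : C4 = ⋃ j : Fin 4, (fun x => (4 : ℝ)⁻¹ • x + cantorZ j) '' C4)
    {x : E2} (hx : x ∈ C4) :
    ∃ y ∈ C4, ∃ j : Fin 4, slant x = 4⁻¹ * slant y + 3 / 4 * (j : ℕ) := by
  rw [hinv] at hx
  obtain ⟨j, y, hy, rfl⟩ := mem_iUnion.1 hx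
  exact ⟨y, hy, j, by dsimp only; rw [slant_smul_add, slant_cantorZ]⟩

lemma slant_mem_Icc (hc : IsCompact C4)
    (hinv : C4 = ⋃ j : Fin 4, (fun x => (4 : ℝ)⁻¹ • x + cantorZ j) '' C4)
    {x : E2} (hx : x ∈ C4) : slant x ∈ Icc (0 : ℝ) 3 := by
  obtain ⟨a, ha, hmin⟩ := hc.exists_isMinOn ⟨x, hx⟩ continuous_slant.continuousOn
  obtain ⟨b, hb, hmax⟩ := hc.exists_isMaxOn ⟨x, hx⟩ continuous_slant.continuousOn
  obtain ⟨a', ha', i, hi⟩ := exists_preimage_attractor hinv ha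
  obtain ⟨b', hb', j, hj⟩ := exists_preimage_attractor hinv hb
  have h1 : slant a ≤ slant a' := hmin ha'
  have h2 : slant b' ≤ slant b := hmax hb'
  have h3 : slant a ≤ slant x := hmin hx
  have h4 : slant x ≤ slant b := hmax hx
  have h5 : ((j : ℕ) : ℝ) ≤ 3 := by exact_mod_cast Nat.lt_succ_iff.1 j.isLt
  have h6 : (0 : ℝ) ≤ (i : ℕ) := by positivity
  constructor <;> linarith

/-- The `n`-fold compositions of the Cantor maps project to the `4 ^ n` intervals of length
`3 / 4 ^ n` tiling `[0, 3]`. -/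
lemma exists_iterate_map
    (hinv : C4 = ⋃ j : Fin 4, (fun x => (4 : ℝ)⁻¹ • x + cantorZ j) '' C4) (n : ℕ) :
    ∀ a : ℕ, a < 4 ^ n → ∃ z : E2, (∀ x ∈ C4, ((4 : ℝ) ^ n)⁻¹ • x + z ∈ C4) ∧
      slant z = 3 * (a : ℝ) / 4 ^ n := by
  induction n with
  | zero =>
    intro a ha
    obtain rfl : a = 0 := by simpa using ha
    exact ⟨0, fun x hx => by simpa using hx, by simp [slant]⟩
  | succ n ih =>
    intro a ha
    obtain ⟨z, hz, hs⟩ := ih (a / 4) (by rw [pow_succ] at ha; omega)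
    let j : Fin 4 := ⟨a % 4, Nat.mod_lt _ (by norm_num)⟩
    refine ⟨((4 : ℝ) ^ n)⁻¹ • cantorZ j + z, fun x hx => ?_, ?_⟩
    · convert! hz _ (map_mem_attractor hinv j hx) using 1
      rw [smul_add, smul_smul, pow_succ, mul_inv, add_assoc]
    · have ha' : (a : ℝ) = 4 * (a / 4 : ℕ) + (a % 4 : ℕ) := by
        exact_mod_cast (Nat.div_add_mod a 4).symm
      rw [slant_smul_add, slant_cantorZ, hs, ha', pow_succ]
      field_simp
      simp only [j]
      ring

/-- Keeping every other square of generation `m + 1` yields a subset of the Cantor set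
of dimension `1 - 1 / (2 (m + 1))` on a graph of Lipschitz constant `≲ 4 ^ (m + 1)`. -/
lemma exists_isLipGraph_le_dimH (hc : IsCompact C4) (hne : C4.Nonempty)
    (hinv : C4 = ⋃ j : Fin 4, (fun x => (4 : ℝ)⁻¹ • x + cantorZ j) '' C4) (m : ℕ)
    {L : ℝ} (hL : diam C4 * 4 ^ (m + 1) ≤ L) :
    ∃ Γ : Set E2, IsLipGraph Γ L ∧
      ENNReal.ofReal (1 - 1 / (2 * ((m : ℝ) + 1))) ≤ dimH (C4 ∩ Γ) := by
  classical
  set Q : ℝ := 4 ^ (m + 1) with hQdef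
  have hQ1 : 1 < Q := one_lt_pow₀ (by norm_num) (by omega)
  have hQ0 : 0 < Q := by linarith
  have hM : 1 < 2 * 4 ^ m := by have := Nat.one_le_pow m 4 (by norm_num); omega
  have hpow : (4 : ℕ) ^ (m + 1) = 2 * (2 * 4 ^ m) := by rw [pow_succ]; ring
  have hex : ∀ b : Fin (2 * 4 ^ m), ∃ z : E2, (∀ x ∈ C4, Q⁻¹ • x + z ∈ C4) ∧
      slant z = 6 * (b : ℕ) / Q := fun b => by
    obtain ⟨z, hz, hs⟩ := exists_iterate_map hinv (m + 1) (2 * b) (by have := b.isLt; omega)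
    exact ⟨z, hz, by rw [hs]; push_cast; ring⟩
  choose z hz hzs using hex
  obtain ⟨P, hPC, hP⟩ := exists_coding hc hne (inv_nonneg.2 hQ0.le) (inv_lt_one_of_one_lt₀ hQ1) z hz
  have hsep := le_abs_slant_sub hQ0 z hzs P hP (fun σ => (slant_mem_Icc hc hinv (hPC σ)).1)
    (fun σ => (slant_mem_Icc hc hinv (hPC σ)).2)
  have hclose := dist_coding_le hQ0 z P hP
    (fun σ τ => dist_le_diam_of_mem hc.isBounded (hPC σ) (hPC τ))
  have h5 : √5 ≤ 3 := Real.sqrt_le_iff.2 ⟨by norm_num, by norm_num⟩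
  have h5' : 0 < √5 := by positivity
  obtain ⟨Γ, hΓ, hsub⟩ := exists_isLipGraph P (L := L) (fun σ τ => by
    rcases eq_or_ne σ τ with rfl | hne
    · simp
    have hfind := Function.ne_iff.1 hne
    set k := Nat.find hfind
    have hk : ∀ i < k, σ i = τ i := fun i hi => not_not.1 (Nat.find_min hfind hi)
    have h1 := hsep k σ τ hk (Nat.find_spec hfind)
    have h2 : (Q ^ (k + 1))⁻¹ ≤ |slant (P σ) / √5 - slant (P τ) / √5| := by
      rw [← sub_div, abs_div, abs_of_pos h5', le_div_iff₀ h5']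
      refine le_trans ?_ h1
      rw [mul_comm]
      gcongr
    calc dist (P σ) (P τ) ≤ diam C4 * (Q ^ k)⁻¹ := hclose k σ τ hk
      _ = diam C4 * Q * (Q ^ (k + 1))⁻¹ := by rw [pow_succ]; field_simp
      _ ≤ L * |slant (P σ) / √5 - slant (P τ) / √5| :=
        mul_le_mul hL h2 (by positivity) (le_trans (by positivity) hL))
  refine ⟨Γ, hΓ, le_trans ?_ (dimH_mono (subset_inter (range_subset_iff.2 hPC) hsub))⟩
  have hm : (0 : ℝ) ≤ m := by positivity
  refine le_dimH_range_coding hM hQ1 ?_ ?_ P fun k σ τ hk hk' => ?_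
  · rw [sub_pos, div_lt_one (by positivity)]
    linarith
  · have hexp : (2 : ℝ) * (m + 1) * (1 - 1 / (2 * ((m : ℝ) + 1))) = (2 * m + 1 : ℕ) := by
      push_cast; field_simp; ring
    have hQ2 : Q = 2 ^ ((2 : ℝ) * (m + 1)) := by
      rw [Real.rpow_mul (by norm_num), hQdef]
      norm_num
      exact_mod_cast (Real.rpow_natCast (4 : ℝ) (m + 1)).symm
    rw [hQ2, ← Real.rpow_mul (by norm_num), hexp, Real.rpow_natCast, pow_succ, pow_mul]
    push_cast
    norm_num
    ring
  · have h1 := (hsep k σ τ hk hk').trans (abs_slant_sub_le _ _)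
    have h2 : √5 * dist (P σ) (P τ) ≤ 3 * dist (P σ) (P τ) := by gcongr
    linarith

end Attractor

/-- There is a universal constant `c > 0` so that for every `ε ∈ (0,1/2)` there is a Lipschitz
graph `Γ` with `dim (𝒞₄ ∩ Γ) ≥ 1 − ε` and `Lip(Γ) ≤ c·2^{1/ε}`, where `𝒞₄` is the 4-corner
Cantor set (the attractor of the IFS `x ↦ x/4 + z_j`). -/
theorem statement6 (C4 : Set E2) (hc : IsCompact C4) (hne : C4.Nonempty)
    (hinv : C4 = ⋃ j : Fin 4, (fun x => (4 : ℝ)⁻¹ • x + cantorZ j) '' C4) :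
    ∃ c : ℝ, 0 < c ∧ ∀ ε : ℝ, ε ∈ Set.Ioo (0 : ℝ) (1 / 2) →
      ∃ Γ : Set E2, IsLipGraph Γ (c * (2 : ℝ) ^ (1 / ε)) ∧
        ENNReal.ofReal (1 - ε) ≤ dimH (C4 ∩ Γ) := by
  refine ⟨4 * (diam C4 + 1), by have := diam_nonneg (s := C4); linarith, fun ε hε => ?_⟩
  obtain ⟨hε0, -⟩ := hε
  set m : ℕ := ⌊1 / (2 * ε)⌋₊ with hm
  have hm1 : 1 / (2 * ε) < m + 1 := Nat.lt_floor_add_one _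
  have hm2 : (m : ℝ) ≤ 1 / (2 * ε) := Nat.floor_le (by positivity)
  have hpow : (4 : ℝ) ^ (m + 1) ≤ 4 * 2 ^ (1 / ε) := by
    have h4 : (4 : ℝ) ^ m = 2 ^ (2 * (m : ℝ)) := by
      rw [Real.rpow_mul (by norm_num), Real.rpow_natCast]
      norm_num
    have hle : 2 * (m : ℝ) ≤ 1 / ε := by
      calc 2 * (m : ℝ) ≤ 2 * (1 / (2 * ε)) := by gcongr
        _ = 1 / ε := by field_simp
    rw [pow_succ, mul_comm, h4]
    gcongr
    norm_num
  have hdiam := diam_nonneg (s := C4)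
  obtain ⟨Γ, hΓ, hdim⟩ := exists_isLipGraph_le_dimH hc hne hinv m
    (L := 4 * (diam C4 + 1) * 2 ^ (1 / ε)) (by
      calc diam C4 * 4 ^ (m + 1) ≤ (diam C4 + 1) * (4 * 2 ^ (1 / ε)) := by gcongr; linarith
        _ = _ := by ring)
  refine ⟨Γ, hΓ, le_trans (ENNReal.ofReal_le_ofReal ?_) hdim⟩
  have : 1 / (2 * ((m : ℝ) + 1)) ≤ ε := by
    rw [div_lt_iff₀ (by positivity)] at hm1
    rw [div_le_iff₀ (by positivity)]
    linarith
  linarith
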